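/- arXiv:2309.08419 — 3 statements merged into one kernel-verified Lean document; each statement's English description precedes it below -/
import Mathlib

section
/- Let β > 0 and let m ≥ 1 be an integer. Let W : (0,∞) → ℂ be twice continuously differentiable with W''(ζ) = (m² − β²/ζ²) W(ζ) for all ζ > 0, and suppose there exist constants C₀ > 0 and θ ∈ (0,1] such that |W(ζ)| ≤ C₀ ζ^θ and |W'(ζ)| ≤ C₀ ζ^{θ−1} for 0 < ζ ≤ 1, and |W(ζ)| + |W'(ζ)| ≤ C₀ e^{−ζ/C₀} for ζ ≥ 1. Let ρ⁰, ω⁰ : ℝ → ℂ be smooth and compactly supported, let c ∈ ℂ, and define G_m(η,ξ,y) = (∂_y² − m²)(ρ⁰(ξ+y−η) − β^{−2} ξ ω⁰(ξ+y−η)), Ψ_m(t,y) = c [∫₀^∞ e^{imηt} W(η) ∫₀^∞ W(ξ) G_m(η,ξ,y) dξ dη − ∫₀^∞ e^{−imηt} W(η) ∫₀^∞ W(ξ) G_m(−η,−ξ,y) dξ dη], P_m(t,y) = c [∫₀^∞ e^{imηt} (W(η)/η) ∫₀^∞ W(ξ) G_m(η,ξ,y) dξ dη + ∫₀^∞ e^{−imηt}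 (W(η)/η) ∫₀^∞ W(ξ) G_m(−η,−ξ,y) dξ dη], and Ω_m(t,y) = −m²t²Ψ_m(t,y) − 2imt ∂_yΨ_m(t,y) + (∂_y² − m²)Ψ_m(t,y). Then for all t ∈ ℝ and y ∈ ℝ one has ∂_t P_m(t,y) = im Ψ_m(t,y) and ∂_t Ω_m(t,y) = −imβ² P_m(t,y); equivalently, ψ_m(t,y) = e^{−imyt}Ψ_m(t,y) and ρ_m(t,y) = e^{−imyt}P_m(t,y) satisfy the linearized Euler–Boussinesq system (∂_t + imy)(∂_y² − m²)ψ_m = −imβ² ρ_m and (∂_t + imy)ρ_m = im ψ_m. -/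
open MeasureTheory Complex Set Filter Topology
open scoped ENNReal Real

noncomputable section

/-- Bounded continuous functions on the line. -/
def BddCont (k : ℝ → ℂ) : Prop := Continuous k ∧ ∃ M : ℝ, ∀ x, ‖k x‖ ≤ M

lemma BddCont.add {k l : ℝ → ℂ} (hk : BddCont k) (hl : BddCont l) :
    BddCont (fun x => k x + l x) := by
  obtain ⟨hk, M, hM⟩ := hk
  obtain ⟨hl, N, hN⟩ := hl
  exact ⟨hk.add hl, M + N, fun x => (norm_add_le _ _).trans (add_le_add (hM x) (hN x))⟩

lemma BddCont.of_hasCompactSupport {k : ℝ → ℂ} (hk : Continuous k) (hs : HasCompactSupport k) :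
    BddCont k :=
  ⟨hk, hs.exists_bound_of_continuous hk⟩

lemma BddCont.integrable_mul {μ : Measure ℝ} {v k : ℝ → ℂ} (hv : Integrable v μ)
    (hk : BddCont k) (s y : ℝ) : Integrable (fun η => v η * k (y + s * η)) μ := by
  obtain ⟨hc, M, hM⟩ := hk
  have hc' : Continuous fun η : ℝ => k (y + s * η) := hc.comp (by fun_prop)
  exact hv.mul_bdd (c := M) hc'.aestronglyMeasurable (ae_of_all _ fun η => hM _)

lemma BddCont.integral_mul {μ : Measure ℝ} {v k : ℝ → ℂ} (hv : Integrable v μ)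
    (hk : BddCont k) (s : ℝ) : BddCont (fun y => ∫ η, v η * k (y + s * η) ∂μ) := by
  have hk' := hk
  obtain ⟨hc, M, hM⟩ := hk'
  have hb : ∀ y η : ℝ, ‖v η * k (y + s * η)‖ ≤ ‖v η‖ * M := fun y η => by
    rw [norm_mul]; exact mul_le_mul_of_nonneg_left (hM _) (norm_nonneg _)
  refine ⟨continuous_of_dominated (fun y => (hk.integrable_mul hv s y).aestronglyMeasurable)
    (fun y => ae_of_all _ (hb y)) (hv.norm.mul_const M)
    (ae_of_all _ fun η => continuous_const.mul (hc.comp (by fun_prop))),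
    ∫ η, ‖v η‖ * M ∂μ, fun y => ?_⟩
  exact norm_integral_le_of_norm_le (hv.norm.mul_const M) (ae_of_all _ (hb y))

lemma hasDerivAt_integral_mul_translate {μ : Measure ℝ} {v k k' : ℝ → ℂ} (hv : Integrable v μ)
    (hk : BddCont k) (hk' : BddCont k') (hd : ∀ x, HasDerivAt k (k' x) x) (s y : ℝ) :
    HasDerivAt (fun y => ∫ η, v η * k (y + s * η) ∂μ) (∫ η, v η * k' (y + s * η) ∂μ) y := by
  have hk'' := hk'
  obtain ⟨-, M, hM⟩ := hk''
  refine (hasDerivAt_integral_of_dominated_loc_of_deriv_le (bound := fun η => ‖v η‖ * M)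
    (F := fun y η => v η * k (y + s * η)) (F' := fun y η => v η * k' (y + s * η))
    univ_mem (Eventually.of_forall fun y => (hk.integrable_mul hv s y).aestronglyMeasurable)
    (hk.integrable_mul hv s y) (hk'.integrable_mul hv s y).aestronglyMeasurable
    (ae_of_all _ fun η x _ => ?_) (hv.norm.mul_const M) (ae_of_all _ fun η x _ => ?_)).2
  · rw [norm_mul]; exact mul_le_mul_of_nonneg_left (hM _) (norm_nonneg _)
  · exact ((hd (x + s * η)).comp_add_const x (s * η)).const_mul (v η)

/-- Integral over the half-line of a weight `w` times a translate of `k`, with phase `a * η * t`. -/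
def osc (a s : ℝ) (w k : ℝ → ℂ) (t y : ℝ) : ℂ :=
  ∫ η in Ioi (0 : ℝ), cexp ((a * η * t : ℝ) * I) * w η * k (y + s * η)

lemma integrable_phase_mul {μ : Measure ℝ} {v : ℝ → ℂ} (hv : Integrable v μ) (a t : ℝ) :
    Integrable (fun η : ℝ => cexp ((a * η * t : ℝ) * I) * v η) μ :=
  hv.bdd_mul (c := 1) (Continuous.aestronglyMeasurable (by fun_prop))
    (ae_of_all _ fun η => (norm_exp_ofReal_mul_I _).le)

lemma hasDerivAt_integral_phase_mul {μ : Measure ℝ} {v : ℝ → ℂ} (hv : Integrable v μ)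
    (hv' : Integrable (fun η : ℝ => (η : ℂ) * v η) μ) (a t : ℝ) :
    HasDerivAt (fun t => ∫ η : ℝ, cexp ((a * η * t : ℝ) * I) * v η ∂μ)
      (∫ η : ℝ, cexp ((a * η * t : ℝ) * I) * (a * I * (η * v η)) ∂μ) t := by
  have hv'' := hv'.const_mul (a * I)
  refine (hasDerivAt_integral_of_dominated_loc_of_deriv_le
    (bound := fun η : ℝ => ‖a * I * (η * v η)‖)
    (F := fun t η => cexp ((a * η * t : ℝ) * I) * v η)
    (F' := fun t η => cexp ((a * η * t : ℝ) * I) * (a * I * (η * v η)))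
    univ_mem
    (Eventually.of_forall fun y => (integrable_phase_mul hv a y).aestronglyMeasurable)
    (integrable_phase_mul hv a t) (integrable_phase_mul hv'' a t).aestronglyMeasurable
    (ae_of_all _ fun η x _ => ?_) hv''.norm (ae_of_all _ fun η x _ => ?_)).2
  · rw [norm_mul, norm_exp_ofReal_mul_I, one_mul]
  · have h1 : HasDerivAt (fun t : ℝ => ((a * η * t : ℝ) : ℂ) * I) (((a * η : ℝ) : ℂ) * I) x := by
      have := ((hasDerivAt_id x).const_mul (a * η)).ofReal_comp.mul_const I
      simpa using this
    refine (h1.cexp.mul_const (v η)).congr_deriv ?_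
    push_cast
    ring

section osc

variable {w k k' : ℝ → ℂ}

lemma integrable_osc (hw : IntegrableOn w (Ioi 0)) (hk : BddCont k) (a s t y : ℝ) :
    IntegrableOn (fun η : ℝ => cexp ((a * η * t : ℝ) * I) * w η * k (y + s * η)) (Ioi 0) :=
  hk.integrable_mul (integrable_phase_mul hw a t) s y

lemma hasDerivAt_osc_right (hw : IntegrableOn w (Ioi 0)) (hk : BddCont k) (hk' : BddCont k')
    (hd : ∀ x, HasDerivAt k (k' x) x) (a s t y : ℝ) :
    HasDerivAt (fun y => osc a s w k t y) (osc a s w k' t y) y :=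
  hasDerivAt_integral_mul_translate (integrable_phase_mul hw a t) hk hk' hd s y

lemma hasDerivAt_osc_left (hw : IntegrableOn w (Ioi 0))
    (hw' : IntegrableOn (fun η : ℝ => (η : ℂ) * w η) (Ioi 0)) (hk : BddCont k) (a s t y : ℝ) :
    HasDerivAt (fun t => osc a s w k t y)
      (a * I * osc a s (fun η => (η : ℂ) * w η) k t y) t := by
  have h := hasDerivAt_integral_phase_mul (hk.integrable_mul hw s y)
    (by simpa only [mul_assoc] using! hk.integrable_mul hw' s y) a t
  unfold osc
  rw [← integral_const_mul]
  convert h using 1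
  · simp only [mul_assoc]
  · congr 1
    ext η
    ring

end osc

/-- Green's identity for `W` and `η ↦ η * exp (i a t η) * k (y + s η)` on the half-line: the
boundary terms vanish. -/
lemma integral_green_eq_zero {W W₁ W₂ k k₁ k₂ : ℝ → ℂ} {C₀ θ : ℝ} (hC₀ : 0 < C₀) (hθ : 0 < θ)
    (hd : ∀ ζ, 0 < ζ → HasDerivAt W (W₁ ζ) ζ) (hd₁ : ∀ ζ, 0 < ζ → HasDerivAt W₁ (W₂ ζ) ζ)
    (hsmall : ∀ ζ : ℝ, 0 < ζ → ζ ≤ 1 → ‖W ζ‖ ≤ C₀ * ζ ^ θ ∧ ‖W₁ ζ‖ ≤ C₀ * ζ ^ (θ - 1))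
    (hlarge : ∀ ζ : ℝ, 1 ≤ ζ → ‖W ζ‖ + ‖W₁ ζ‖ ≤ C₀ * Real.exp (-ζ / C₀))
    (hk : BddCont k) (hk₁ : BddCont k₁)
    (hkd : ∀ x, HasDerivAt k (k₁ x) x) (hkd₁ : ∀ x, HasDerivAt k₁ (k₂ x) x) (a s t y : ℝ)
    (hint : IntegrableOn (fun η : ℝ => cexp ((a * η * t : ℝ) * I) *
      (W η * (2 * (a * t * I * k (y + s * η) + s * k₁ (y + s * η)) +
        η * ((a * t * I) ^ 2 * k (y + s * η) + 2 * (a * t * I) * s * k₁ (y + s * η) +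
          s ^ 2 * k₂ (y + s * η))) - W₂ η * (η * k (y + s * η)))) (Ioi 0)) :
    ∫ η in Ioi (0 : ℝ), cexp ((a * η * t : ℝ) * I) *
      (W η * (2 * (a * t * I * k (y + s * η) + s * k₁ (y + s * η)) +
        η * ((a * t * I) ^ 2 * k (y + s * η) + 2 * (a * t * I) * s * k₁ (y + s * η) +
          s ^ 2 * k₂ (y + s * η))) - W₂ η * (η * k (y + s * η))) = 0 := by
  obtain ⟨-, M, hM⟩ := hk
  obtain ⟨-, N, hN⟩ := hk₁
  have hM0 : 0 ≤ M := (norm_nonneg _).trans (hM 0)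
  have hN0 : 0 ≤ N := (norm_nonneg _).trans (hN 0)
  set E : ℝ → ℂ := fun η => cexp ((a * η * t : ℝ) * I) with hE
  have hEn : ∀ η, ‖E η‖ = 1 := fun η => norm_exp_ofReal_mul_I _
  have hEd : ∀ η, HasDerivAt E (a * t * I * E η) η := fun η => by
    have h1 : HasDerivAt (fun η : ℝ => ((a * η * t : ℝ) : ℂ) * I) (((a * t : ℝ) : ℂ) * I) η := by
      have := (((hasDerivAt_id η).const_mul a).mul_const t).ofReal_comp.mul_const I
      simpa using this
    convert h1.cexp using 1
    push_cast [hE]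
    ring
  have htr : ∀ {f f' : ℝ → ℂ}, (∀ x, HasDerivAt f (f' x) x) → ∀ η : ℝ,
      HasDerivAt (fun η => f (y + s * η)) (s * f' (y + s * η)) η := fun {f f'} hf η => by
    have h1 : HasDerivAt (fun η : ℝ => y + s * η) s η := by
      simpa using ((hasDerivAt_id η).const_mul s).const_add y
    simpa [Function.comp_def] using (hf (y + s * η)).scomp η h1
  set u : ℝ → ℂ := fun η => η * (E η * k (y + s * η)) with hu
  set u₁ : ℝ → ℂ := fun η => E η * k (y + s * η) +
    η * (a * t * I * (E η * k (y + s * η)) + s * (E η * k₁ (y + s * η))) with hu₁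
  set F : ℝ → ℂ := fun η => W η * u₁ η - W₁ η * u η with hF
  have hid : ∀ η : ℝ, HasDerivAt (fun η : ℝ => (η : ℂ)) 1 η := fun η => (hasDerivAt_id η).ofReal_comp
  have hEk := fun η => (hEd η).mul (htr hkd η)
  have hEk₁ := fun η => (hEd η).mul (htr hkd₁ η)
  have hud : ∀ η, HasDerivAt u (u₁ η) η := fun η => by
    refine ((hid η).mul (hEk η)).congr_deriv ?_
    simp only [hu₁, Pi.mul_apply]
    ring
  have hu₁d := fun η => (hEk η).add ((hid η).mul
    (((hEk η).const_mul (a * t * I : ℂ)).add ((hEk₁ η).const_mul (s : ℂ))))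
  have hun : ∀ η, 0 < η → ‖u η‖ ≤ η * M := fun η h => by
    simp only [hu, norm_mul, hEn, one_mul, norm_real, Real.norm_of_nonneg h.le]
    exact mul_le_mul_of_nonneg_left (hM _) h.le
  set R : ℝ := |a * t| * M + |s| * N with hR
  have hR0 : 0 ≤ R := by positivity
  have hu₁n : ∀ η, 0 < η → ‖u₁ η‖ ≤ M + η * R := fun η h => by
    refine (norm_add_le _ _).trans (add_le_add ?_ ?_)
    · rw [norm_mul, hEn, one_mul]; exact hM _
    · rw [norm_mul, norm_real, Real.norm_of_nonneg h.le]
      refine mul_le_mul_of_nonneg_left ((norm_add_le _ _).trans ?_) h.le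
      simp only [norm_mul, hEn, one_mul, norm_real, norm_I, mul_one, Real.norm_eq_abs, hR, abs_mul]
      gcongr
      exacts [hM _, hN _]
  have hFn : ∀ η, 0 < η → ‖F η‖ ≤ ‖W η‖ * (M + η * R) + ‖W₁ η‖ * (η * M) := fun η h => by
    refine (norm_sub_le _ _).trans ?_
    rw [norm_mul, norm_mul]
    gcongr
    exacts [hu₁n η h, hun η h]
  have h_zero : Tendsto F (𝓝[>] 0) (𝓝 0) := by
    have hlim : Tendsto (fun η : ℝ => C₀ * η ^ θ * (2 * M + η * R)) (𝓝[>] 0) (𝓝 0) := by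
      have : ContinuousAt (fun η : ℝ => C₀ * η ^ θ * (2 * M + η * R)) 0 := by
        have := Real.continuousAt_rpow_const 0 θ (Or.inr hθ.le)
        fun_prop
      have h := this.tendsto
      simp only [Real.zero_rpow hθ.ne', mul_zero, zero_mul] at h
      exact h.mono_left nhdsWithin_le_nhds
    refine squeeze_zero_norm' ?_ hlim
    filter_upwards [Ioc_mem_nhdsGT (zero_lt_one (α := ℝ))] with η hη
    obtain ⟨h1, h2⟩ := hsmall η hη.1 hη.2
    have h0 := hη.1
    have hpow : η ^ (θ - 1) * η = η ^ θ := by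
      rw [← Real.rpow_add_one h0.ne', sub_add_cancel]
    calc ‖F η‖ ≤ ‖W η‖ * (M + η * R) + ‖W₁ η‖ * (η * M) := hFn η h0
      _ ≤ C₀ * η ^ θ * (M + η * R) + C₀ * η ^ (θ - 1) * (η * M) := by gcongr
      _ = C₀ * η ^ θ * (2 * M + η * R) := by rw [← hpow]; ring
  have h_infty : Tendsto F atTop (𝓝 0) := by
    have hlim : Tendsto (fun η : ℝ => C₀ * Real.exp (-η / C₀) * (M + η * (R + M)))
        atTop (𝓝 0) := by
      have e0 := tendsto_rpow_mul_exp_neg_mul_atTop_nhds_zero 0 C₀⁻¹ (inv_pos.2 hC₀)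
      have e1 := tendsto_rpow_mul_exp_neg_mul_atTop_nhds_zero 1 C₀⁻¹ (inv_pos.2 hC₀)
      have := (e0.const_mul (C₀ * M)).add (e1.const_mul (C₀ * (R + M)))
      simp only [mul_zero, add_zero] at this
      refine this.congr fun η => ?_
      rw [Real.rpow_zero, Real.rpow_one, show -C₀⁻¹ * η = -η / C₀ by ring]
      ring
    refine squeeze_zero_norm' ?_ hlim
    filter_upwards [eventually_ge_atTop 1] with η hη
    have h0 : 0 < η := by linarith
    have h := hlarge η hη
    have hexp : 0 ≤ C₀ * Real.exp (-η / C₀) := by positivity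
    calc ‖F η‖ ≤ ‖W η‖ * (M + η * R) + ‖W₁ η‖ * (η * M) := hFn η h0
      _ ≤ (‖W η‖ + ‖W₁ η‖) * (M + η * (R + M)) := by
        have := mul_nonneg (norm_nonneg (W η)) (mul_nonneg h0.le hM0)
        have := mul_nonneg (norm_nonneg (W₁ η)) (add_nonneg hM0 (mul_nonneg h0.le hR0))
        linarith
      _ ≤ C₀ * Real.exp (-η / C₀) * (M + η * (R + M)) := by gcongr
  have key := integral_Ioi_deriv_mul_eq_sub (a := (0 : ℝ)) (u := F) (v := fun _ => 1)
    (v' := fun _ => 0) (a' := 0) (b' := 0)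
    (u' := fun η : ℝ => E η *
      (W η * (2 * (a * t * I * k (y + s * η) + s * k₁ (y + s * η)) +
        η * ((a * t * I) ^ 2 * k (y + s * η) + 2 * (a * t * I) * s * k₁ (y + s * η) +
          s ^ 2 * k₂ (y + s * η))) - W₂ η * (η * k (y + s * η))))
    (fun η hη => by
      refine (((hd η hη).mul (hu₁d η)).sub ((hd₁ η hη).mul (hud η))).congr_deriv ?_
      simp only [hu₁, hu, Pi.add_apply, Pi.mul_apply]
      ring)
    (fun η _ => hasDerivAt_const η 1)
    (by simpa [hE, Pi.mul_def, Pi.add_def] using hint)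
    (by simpa [Pi.mul_def] using h_zero) (by simpa [Pi.mul_def] using h_infty)
  simpa [hE] using key

lemma hasDerivAt_osc_vorticity {W W₁ k k₁ k₂ : ℝ → ℂ} {C₀ θ s : ℝ} {b m : ℂ} (hC₀ : 0 < C₀)
    (hθ : 0 < θ) (hs : s ^ 2 = 1) (a : ℝ) (ha : (a : ℂ) = -s * m)
    (hd : ∀ ζ, 0 < ζ → HasDerivAt W (W₁ ζ) ζ)
    (hd₁ : ∀ ζ : ℝ, 0 < ζ → HasDerivAt W₁ ((m ^ 2 - b ^ 2 / (ζ : ℂ) ^ 2) * W ζ) ζ)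
    (hsmall : ∀ ζ : ℝ, 0 < ζ → ζ ≤ 1 → ‖W ζ‖ ≤ C₀ * ζ ^ θ ∧ ‖W₁ ζ‖ ≤ C₀ * ζ ^ (θ - 1))
    (hlarge : ∀ ζ : ℝ, 1 ≤ ζ → ‖W ζ‖ + ‖W₁ ζ‖ ≤ C₀ * Real.exp (-ζ / C₀))
    (hi₀ : IntegrableOn (fun η : ℝ => W η / (η : ℂ)) (Ioi 0)) (hi₁ : IntegrableOn W (Ioi 0))
    (hi₂ : IntegrableOn (fun η : ℝ => (η : ℂ) * W η) (Ioi 0))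
    (hk : BddCont k) (hk₁ : BddCont k₁) (hk₂ : BddCont k₂)
    (hkd : ∀ x, HasDerivAt k (k₁ x) x) (hkd₁ : ∀ x, HasDerivAt k₁ (k₂ x) x) (t y : ℝ) :
    HasDerivAt (fun t : ℝ => -m ^ 2 * (t : ℂ) ^ 2 * osc a s W k t y
        - 2 * I * m * t * osc a s W k₁ t y + (osc a s W k₂ t y - m ^ 2 * osc a s W k t y))
      (s * I * m * b ^ 2 * osc a s (fun η => W η / (η : ℂ)) k t y) t := by
  have hs' : (s : ℂ) ^ 2 = 1 := by exact_mod_cast hs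
  have j₀ := integrable_osc hi₀ hk a s t y
  have j₁ := integrable_osc hi₁ hk a s t y
  have j₂ := integrable_osc hi₁ hk₁ a s t y
  have j₃ := integrable_osc hi₂ hk a s t y
  have j₄ := integrable_osc hi₂ hk₁ a s t y
  have j₅ := integrable_osc hi₂ hk₂ a s t y
  have c₀ := j₀.const_mul (b ^ 2)
  have c₁ := j₁.const_mul (2 * (a * t * I))
  have c₂ := j₂.const_mul (2 * (s : ℂ))
  have c₃ := j₃.const_mul ((a * t * I) ^ 2 - m ^ 2)
  have c₄ := j₄.const_mul (2 * (a * t * I) * s)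
  have c₅ := j₅.const_mul ((s : ℂ) ^ 2)
  have hEq : EqOn (fun η : ℝ =>
      b ^ 2 * (cexp ((a * η * t : ℝ) * I) * (W η / (η : ℂ)) * k (y + s * η)) +
      2 * (a * t * I) * (cexp ((a * η * t : ℝ) * I) * W η * k (y + s * η)) +
      2 * s * (cexp ((a * η * t : ℝ) * I) * W η * k₁ (y + s * η)) +
      ((a * t * I) ^ 2 - m ^ 2) * (cexp ((a * η * t : ℝ) * I) * (η * W η) * k (y + s * η)) +
      2 * (a * t * I) * s * (cexp ((a * η * t : ℝ) * I) * (η * W η) * k₁ (y + s * η)) +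
      s ^ 2 * (cexp ((a * η * t : ℝ) * I) * (η * W η) * k₂ (y + s * η)))
    (fun η : ℝ => cexp ((a * η * t : ℝ) * I) *
      (W η * (2 * (a * t * I * k (y + s * η) + s * k₁ (y + s * η)) +
        η * ((a * t * I) ^ 2 * k (y + s * η) + 2 * (a * t * I) * s * k₁ (y + s * η) +
          s ^ 2 * k₂ (y + s * η))) -
        ((m ^ 2 - b ^ 2 / (η : ℂ) ^ 2) * W η) * (η * k (y + s * η)))) (Ioi 0) := by
    intro η hη
    have h0 : (η : ℂ) ≠ 0 := ofReal_ne_zero.2 (ne_of_gt hη)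
    simp only
    field_simp
    ring
  have green := integral_green_eq_zero hC₀ hθ hd hd₁ hsmall hlarge hk hk₁ hkd hkd₁ a s t y
    (IntegrableOn.congr_fun (((((c₀.add c₁).add c₂).add c₃).add c₄).add c₅) hEq measurableSet_Ioi)
  rw [← setIntegral_congr_fun measurableSet_Ioi hEq] at green
  replace green := (integral_add' ((((c₀.add c₁).add c₂).add c₃).add c₄) c₅).symm.trans green
  rw [integral_add' (((c₀.add c₁).add c₂).add c₃) c₄, integral_add' ((c₀.add c₁).add c₂) c₃,
    integral_add' (c₀.add c₁) c₂, integral_add' c₀ c₁] at green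
  simp only [integral_const_mul] at green
  have d := hasDerivAt_osc_left hi₁ hi₂ hk a s t y
  have d₁ := hasDerivAt_osc_left hi₁ hi₂ hk₁ a s t y
  have d₂ := hasDerivAt_osc_left hi₁ hi₂ hk₂ a s t y
  have ht : HasDerivAt (fun t : ℝ => (t : ℂ)) 1 t := (hasDerivAt_id t).ofReal_comp
  refine (((((ht.pow 2).const_mul (-m ^ 2)).mul d).sub ((ht.const_mul (2 * I * m)).mul d₁)).add
    (d₂.sub (d.const_mul (m ^ 2)))).congr_deriv ?_
  simp only [osc, Pi.pow_apply] at green ⊢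
  generalize (∫ η in Ioi (0 : ℝ),
    cexp ((a * η * t : ℝ) * I) * (W η / (η : ℂ)) * k (y + s * η)) = x₀ at green ⊢
  generalize (∫ η in Ioi (0 : ℝ),
    cexp ((a * η * t : ℝ) * I) * W η * k (y + s * η)) = x₁ at green ⊢
  generalize (∫ η in Ioi (0 : ℝ),
    cexp ((a * η * t : ℝ) * I) * W η * k₁ (y + s * η)) = x₂ at green ⊢
  generalize (∫ η in Ioi (0 : ℝ),
    cexp ((a * η * t : ℝ) * I) * (η * W η) * k (y + s * η)) = x₃ at green ⊢
  generalize (∫ η in Ioi (0 : ℝ),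
    cexp ((a * η * t : ℝ) * I) * (η * W η) * k₁ (y + s * η)) = x₄ at green ⊢
  generalize (∫ η in Ioi (0 : ℝ),
    cexp ((a * η * t : ℝ) * I) * (η * W η) * k₂ (y + s * η)) = x₅ at green ⊢
  rw [ha] at green ⊢
  norm_num
  have hI : I ^ 2 = -1 := I_sq
  have hI3 : I ^ 3 = -I := by rw [pow_succ, hI]; ring
  have hs3 : (s : ℂ) ^ 3 = s := by rw [pow_succ, hs']; ring
  have green' : -s * m * I * _ = _ := congrArg (fun z => -s * m * I * z) green
  ring_nf at green' ⊢
  simp only [hI, hI3, hs', hs3] at green' ⊢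
  linear_combination green'

lemma integrableOn_pow_mul_div {W : ℝ → ℂ} {C₀ θ : ℝ} (hC₀ : 0 < C₀) (hθ : 0 < θ)
    (hc : ContinuousOn W (Ioi 0)) (hsmall : ∀ ζ : ℝ, 0 < ζ → ζ ≤ 1 → ‖W ζ‖ ≤ C₀ * ζ ^ θ)
    (hlarge : ∀ ζ : ℝ, 1 ≤ ζ → ‖W ζ‖ ≤ C₀ * Real.exp (-ζ / C₀)) (n : ℕ) :
    IntegrableOn (fun η : ℝ => (η : ℂ) ^ n * (W η / (η : ℂ))) (Ioi 0) := by
  have hmeas : AEStronglyMeasurable (fun η : ℝ => (η : ℂ) ^ n * (W η / (η : ℂ)))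
      (volume.restrict (Ioi 0)) := by
    refine ContinuousOn.aestronglyMeasurable ?_ measurableSet_Ioi
    exact ContinuousOn.mul (by fun_prop) (hc.div (by fun_prop)
      fun η hη => ofReal_ne_zero.2 (ne_of_gt hη))
  rw [← Ioc_union_Ioi_eq_Ioi (zero_le_one (α := ℝ))]
  refine IntegrableOn.union ?_ ?_
  · have hb : IntegrableOn (fun η : ℝ => C₀ * η ^ (θ - 1)) (Ioc 0 1) :=
      ((intervalIntegrable_iff_integrableOn_Ioc_of_le zero_le_one).1
        (intervalIntegral.intervalIntegrable_rpow' (by linarith))).const_mul C₀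
    refine Integrable.mono' hb (hmeas.mono_measure (Measure.restrict_mono Ioc_subset_Ioi_self le_rfl))
      ((ae_restrict_mem measurableSet_Ioc).mono fun η hη => ?_)
    rw [norm_mul, norm_div, norm_pow, norm_real, Real.norm_of_nonneg hη.1.le]
    calc η ^ n * (‖W η‖ / η) ≤ 1 * (C₀ * η ^ θ / η) := by
          have := hη.1
          gcongr
          · exact pow_le_one₀ this.le hη.2
          · exact hsmall η hη.1 hη.2
      _ = C₀ * η ^ (θ - 1) := by rw [Real.rpow_sub_one hη.1.ne']; ring
  · have hb : IntegrableOn (fun η : ℝ => C₀ * (η ^ (n : ℝ) * Real.exp (-C₀⁻¹ * η ^ (1 : ℝ))))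
        (Ioi 1) :=
      ((integrableOn_rpow_mul_exp_neg_mul_rpow (s := n) (neg_one_lt_zero.trans_le n.cast_nonneg)
        one_pos (inv_pos.2 hC₀)).mono_set (Ioi_subset_Ioi zero_le_one)).const_mul C₀
    refine Integrable.mono' hb
      (hmeas.mono_measure (Measure.restrict_mono (Ioi_subset_Ioi zero_le_one) le_rfl))
      ((ae_restrict_mem measurableSet_Ioi).mono fun η (hη : 1 < η) => ?_)
    have h0 : 0 < η := by linarith
    rw [norm_mul, norm_div, norm_pow, norm_real, Real.norm_of_nonneg h0.le]
    calc η ^ n * (‖W η‖ / η) ≤ η ^ n * (C₀ * Real.exp (-η / C₀)) := by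
          gcongr
          exact (div_le_self (norm_nonneg _) hη.le).trans (hlarge η hη.le)
      _ = _ := by
        rw [Real.rpow_natCast, Real.rpow_one, show -C₀⁻¹ * η = -η / C₀ by ring]
        ring

lemma exists_convolution_kernel {W f g : ℝ → ℂ} (hi₁ : IntegrableOn W (Ioi 0))
    (hi₂ : IntegrableOn (fun η : ℝ => (η : ℂ) * W η) (Ioi 0))
    (hf : ContDiff ℝ 2 f) (hfs : HasCompactSupport f)
    (hg : ContDiff ℝ 2 g) (hgs : HasCompactSupport g) (s : ℝ) :
    ∃ k k₁ k₂ : ℝ → ℂ, BddCont k ∧ BddCont k₁ ∧ BddCont k₂ ∧ (∀ x, HasDerivAt k (k₁ x) x) ∧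
      (∀ x, HasDerivAt k₁ (k₂ x) x) ∧
      ∀ z, k z = ∫ ξ in Ioi (0 : ℝ), W ξ * (f (z - s * ξ) + s * ξ * g (z - s * ξ)) := by
  have hi₂' := hi₂.const_mul (s : ℂ)
  have aux : ∀ {h : ℝ → ℂ}, ContDiff ℝ 2 h → HasCompactSupport h →
      BddCont h ∧ BddCont (deriv h) ∧ BddCont (deriv (deriv h)) ∧
      (∀ x, HasDerivAt h (deriv h x) x) ∧ ∀ x, HasDerivAt (deriv h) (deriv (deriv h) x) x := by
    intro h hh hs
    have hh' : ContDiff ℝ 1 (deriv h) := hh.deriv' (n := 1)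
    exact ⟨.of_hasCompactSupport hh.continuous hs,
      .of_hasCompactSupport hh'.continuous hs.deriv,
      .of_hasCompactSupport (hh'.continuous_deriv le_rfl) hs.deriv.deriv,
      fun x => (hh.differentiable two_ne_zero x).hasDerivAt,
      fun x => (hh'.differentiable one_ne_zero x).hasDerivAt⟩
  obtain ⟨f0, f1, f2, fd, fd'⟩ := aux hf hfs
  obtain ⟨g0, g1, g2, gd, gd'⟩ := aux hg hgs
  refine ⟨_, _, _, (f0.integral_mul hi₁ (-s)).add (g0.integral_mul hi₂' (-s)),
    (f1.integral_mul hi₁ (-s)).add (g1.integral_mul hi₂' (-s)),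
    (f2.integral_mul hi₁ (-s)).add (g2.integral_mul hi₂' (-s)), fun x => ?_, fun x => ?_,
    fun z => ?_⟩
  · exact (hasDerivAt_integral_mul_translate hi₁ f0 f1 fd _ x).add
      (hasDerivAt_integral_mul_translate hi₂' g0 g1 gd _ x)
  · exact (hasDerivAt_integral_mul_translate hi₁ f1 f2 fd' _ x).add
      (hasDerivAt_integral_mul_translate hi₂' g1 g2 gd' _ x)
  · rw [← integral_add (f0.integrable_mul hi₁ (-s) z) (g0.integrable_mul hi₂' (-s) z)]
    congr 1
    ext ξ
    rw [neg_mul, ← sub_eq_add_neg]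
    ring

/-- The explicit formulas `Ψ_m`, `P_m`, `Ω_m`, built from truncated
convolutions against an oscillating solution `W` of the rescaled Whittaker equation
`W'' = (m² − β²/ζ²) W`, solve the linearized Euler–Boussinesq system around stratified
Couette flow (Fourier mode `m` in `x`):  `∂_t P_m = i m Ψ_m` and `∂_t Ω_m = −i m β² P_m`. -/
theorem explicit_solution_formula
    (β : ℝ) (hβ : 0 < β) (m : ℕ) (hm : 1 ≤ m)
    (W : ℝ → ℂ) (hW2 : ContDiffOn ℝ 2 W (Set.Ioi 0))
    (hWeq : ∀ ζ : ℝ, 0 < ζ →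
      deriv (deriv W) ζ = ((m : ℂ) ^ 2 - (β : ℂ) ^ 2 / (ζ : ℂ) ^ 2) * W ζ)
    (C₀ θ : ℝ) (hC₀ : 0 < C₀) (hθ : θ ∈ Set.Ioc (0 : ℝ) 1)
    (hWsmall : ∀ ζ : ℝ, 0 < ζ → ζ ≤ 1 →
      ‖W ζ‖ ≤ C₀ * ζ ^ θ ∧ ‖deriv W ζ‖ ≤ C₀ * ζ ^ (θ - 1))
    (hWlarge : ∀ ζ : ℝ, 1 ≤ ζ →
      ‖W ζ‖ + ‖deriv W ζ‖ ≤ C₀ * Real.exp (-ζ / C₀))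
    (ρ₀ ω₀ : ℝ → ℂ)
    (hρ : ContDiff ℝ (⊤ : ℕ∞) ρ₀) (hρs : HasCompactSupport ρ₀)
    (hω : ContDiff ℝ (⊤ : ℕ∞) ω₀) (hωs : HasCompactSupport ω₀)
    (c : ℂ)
    (G : ℝ → ℝ → ℝ → ℂ)
    (hG : ∀ η ξ y : ℝ, G η ξ y =
      (deriv (deriv ρ₀) (ξ + y - η) - (m : ℂ) ^ 2 * ρ₀ (ξ + y - η))
        - (1 / (β : ℂ) ^ 2) * (ξ : ℂ) *
            (deriv (deriv ω₀) (ξ + y - η) - (m : ℂ) ^ 2 * ω₀ (ξ + y - η)))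
    (Ψ P Ω : ℝ → ℝ → ℂ)
    (hΨ : ∀ t y : ℝ, Ψ t y = c *
      ((∫ η in Set.Ioi (0 : ℝ), Complex.exp (Complex.I * m * η * t) * W η *
          ∫ ξ in Set.Ioi (0 : ℝ), W ξ * G η ξ y)
        - ∫ η in Set.Ioi (0 : ℝ), Complex.exp (-(Complex.I * m * η * t)) * W η *
            ∫ ξ in Set.Ioi (0 : ℝ), W ξ * G (-η) (-ξ) y))
    (hP : ∀ t y : ℝ, P t y = c *
      ((∫ η in Set.Ioi (0 : ℝ), Complex.exp (Complex.I * m * η * t) * (W η / (η : ℂ)) *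
          ∫ ξ in Set.Ioi (0 : ℝ), W ξ * G η ξ y)
        + ∫ η in Set.Ioi (0 : ℝ), Complex.exp (-(Complex.I * m * η * t)) * (W η / (η : ℂ)) *
            ∫ ξ in Set.Ioi (0 : ℝ), W ξ * G (-η) (-ξ) y))
    (hΩ : ∀ t y : ℝ, Ω t y =
      -(m : ℂ) ^ 2 * (t : ℂ) ^ 2 * Ψ t y
        - 2 * Complex.I * m * t * deriv (fun y' => Ψ t y') y
        + (deriv (deriv (fun y' => Ψ t y')) y - (m : ℂ) ^ 2 * Ψ t y)) :
    ∀ t y : ℝ,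
      HasDerivAt (fun s => P s y) (Complex.I * m * Ψ t y) t ∧
      HasDerivAt (fun s => Ω s y) (-(Complex.I) * m * (β : ℂ) ^ 2 * P t y) t := by
  have hopen : ∀ ζ : ℝ, 0 < ζ → Ioi (0 : ℝ) ∈ 𝓝 ζ := fun ζ hζ => Ioi_mem_nhds hζ
  have hd : ∀ ζ, 0 < ζ → HasDerivAt W (deriv W ζ) ζ := fun ζ hζ =>
    ((hW2.contDiffAt (hopen ζ hζ)).differentiableAt two_ne_zero).hasDerivAt
  have hd₁ : ∀ ζ : ℝ, 0 < ζ →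
      HasDerivAt (deriv W) (((m : ℂ) ^ 2 - (β : ℂ) ^ 2 / (ζ : ℂ) ^ 2) * W ζ) ζ := fun ζ hζ => by
    have h : ContDiffOn ℝ 1 (deriv W) (Ioi 0) :=
      hW2.deriv_of_isOpen isOpen_Ioi (by norm_num)
    rw [← hWeq ζ hζ]
    exact ((h.contDiffAt (hopen ζ hζ)).differentiableAt one_ne_zero).hasDerivAt
  have hi := integrableOn_pow_mul_div hC₀ hθ.1 hW2.continuousOn
    (fun ζ h h' => (hWsmall ζ h h').1)
    (fun ζ h => (le_add_of_nonneg_right (norm_nonneg _)).trans (hWlarge ζ h))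
  have hi₀ : IntegrableOn (fun η : ℝ => W η / (η : ℂ)) (Ioi 0) := by simpa using hi 0
  have hne : ∀ η ∈ Ioi (0 : ℝ), (η : ℂ) ≠ 0 := fun η hη => ofReal_ne_zero.2 (ne_of_gt hη)
  have hi₁' : IntegrableOn (fun η : ℝ => (η : ℂ) * (W η / (η : ℂ))) (Ioi 0) := by
    simpa using hi 1
  have hcancel : EqOn (fun η : ℝ => (η : ℂ) * (W η / (η : ℂ))) W (Ioi 0) :=
    fun η hη => mul_div_cancel₀ _ (hne η hη)
  have hi₁ : IntegrableOn W (Ioi 0) := hi₁'.congr_fun hcancel measurableSet_Ioi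
  have hi₂ : IntegrableOn (fun η : ℝ => (η : ℂ) * W η) (Ioi 0) :=
    (hi 2).congr_fun (fun η hη => by
      have := hne η hη
      field_simp) measurableSet_Ioi
  have laplacian : ∀ {h : ℝ → ℂ}, ContDiff ℝ (⊤ : ℕ∞) h → HasCompactSupport h → ∀ b : ℂ,
      ContDiff ℝ 2 (fun x => b * (deriv (deriv h) x - (m : ℂ) ^ 2 * h x)) ∧
      HasCompactSupport (fun x => b * (deriv (deriv h) x - (m : ℂ) ^ 2 * h x)) := by
    intro h hh hs b
    have h2 : ContDiff ℝ 2 (deriv (deriv h)) :=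
      ((contDiff_infty.1 hh 4).deriv' (n := 3)).deriv' (n := 2)
    have h0 : ContDiff ℝ 2 h := contDiff_infty.1 hh 2
    exact ⟨contDiff_const.mul (h2.sub (contDiff_const.mul h0)),
      (hs.deriv.deriv.sub hs.mul_left).mul_left⟩
  obtain ⟨hf, hfs⟩ := laplacian hρ hρs 1
  obtain ⟨hg, hgs⟩ := laplacian hω hωs (1 / (β : ℂ) ^ 2)
  obtain ⟨k, k₁, k₂, hk, hk₁, hk₂, hkd, hkd₁, hkG⟩ :=
    exists_convolution_kernel hi₁ hi₂ hf hfs hg hgs (-1)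
  obtain ⟨l, l₁, l₂, hl, hl₁, hl₂, hld, hld₁, hlG⟩ :=
    exists_convolution_kernel hi₁ hi₂ hf hfs hg hgs 1
  have hkG' : ∀ η y : ℝ, ∫ ξ in Ioi (0 : ℝ), W ξ * G η ξ y = k (y + (-1 : ℝ) * η) := by
    intro η y
    rw [hkG]
    congr 1
    ext ξ
    rw [hG, show y + (-1 : ℝ) * η - -1 * ξ = ξ + y - η by ring]
    push_cast
    ring
  have hlG' : ∀ η y : ℝ, ∫ ξ in Ioi (0 : ℝ), W ξ * G (-η) (-ξ) y = l (y + (1 : ℝ) * η) := by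
    intro η y
    rw [hlG]
    congr 1
    ext ξ
    rw [hG, show y + (1 : ℝ) * η - 1 * ξ = -ξ + y - -η by ring]
    push_cast
    ring
  have phase : ∀ η t : ℝ, cexp (I * m * η * t) = cexp (((m : ℝ) * η * t : ℝ) * I) := fun η t => by
    congr 1
    push_cast
    ring
  have phase' : ∀ η t : ℝ, cexp (-(I * m * η * t)) = cexp ((-(m : ℝ) * η * t : ℝ) * I) :=
    fun η t => by
      congr 1
      push_cast
      ring
  have hΨ' : ∀ t y, Ψ t y = c * (osc m (-1) W k t y - osc (-m) 1 W l t y) := by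
    intro t y
    rw [hΨ]
    simp only [hkG', hlG', osc, phase, phase']
  have hP' : ∀ t y, P t y = c * (osc m (-1) (fun η => W η / (η : ℂ)) k t y +
      osc (-m) 1 (fun η => W η / (η : ℂ)) l t y) := by
    intro t y
    rw [hP]
    simp only [hkG', hlG', osc, phase, phase']
  have hΨd : ∀ t y, HasDerivAt (fun y' => Ψ t y')
      (c * (osc m (-1) W k₁ t y - osc (-m) 1 W l₁ t y)) y := by
    intro t y
    simp only [hΨ']
    exact ((hasDerivAt_osc_right hi₁ hk hk₁ hkd _ _ _ _).sub
      (hasDerivAt_osc_right hi₁ hl hl₁ hld _ _ _ _)).const_mul c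
  have hΨd₁ : ∀ t, deriv (fun y' => Ψ t y') =
      fun y => c * (osc m (-1) W k₁ t y - osc (-m) 1 W l₁ t y) :=
    fun t => funext fun y => (hΨd t y).deriv
  have hΨd₂ : ∀ t y, deriv (deriv (fun y' => Ψ t y')) y =
      c * (osc m (-1) W k₂ t y - osc (-m) 1 W l₂ t y) := by
    intro t y
    rw [hΨd₁]
    exact (((hasDerivAt_osc_right hi₁ hk₁ hk₂ hkd₁ _ _ _ _).sub
      (hasDerivAt_osc_right hi₁ hl₁ hl₂ hld₁ _ _ _ _)).const_mul c).deriv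
  have hosc : ∀ (a s : ℝ) (q : ℝ → ℂ) (t y : ℝ),
      osc a s (fun η => (η : ℂ) * (W η / (η : ℂ))) q t y = osc a s W q t y := by
    intro a s q t y
    refine setIntegral_congr_fun measurableSet_Ioi fun η hη => ?_
    simp only [mul_div_cancel₀ _ (hne η hη)]
  intro t y
  constructor
  · simp only [hP', hΨ']
    refine (((hasDerivAt_osc_left hi₀ hi₁' hk m (-1) t y).add
      (hasDerivAt_osc_left hi₀ hi₁' hl (-m) 1 t y)).const_mul c).congr_deriv ?_
    rw [hosc, hosc]
    push_cast
    ring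
  · have dk := hasDerivAt_osc_vorticity hC₀ hθ.1 (s := -1) (by norm_num) m (by simp) hd hd₁ hWsmall
      hWlarge hi₀ hi₁ hi₂ hk hk₁ hk₂ hkd hkd₁ t y
    have dl := hasDerivAt_osc_vorticity hC₀ hθ.1 (s := 1) (by norm_num) (-m) (by simp) hd hd₁
      hWsmall hWlarge hi₀ hi₁ hi₂ hl hl₁ hl₂ hld hld₁ t y
    have hΩ' : (fun t => Ω t y) = _ := funext fun t => by
      rw [hΩ, hΨd₂, hΨd₁, hΨ']
    rw [hΩ', hP']
    refine ((dk.sub dl).const_mul c).congr_of_eventuallyEq (Eventually.of_forall fun t => ?_)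
      |>.congr_deriv ?_
    · simp only [Pi.sub_apply]
      ring
    · push_cast
      ring
end
end

section
/- Let 0 < α < 1, let m ≥ 1 be an integer, set δ₀ = 1/(2m), and let t ≥ 1. Let F : (0,∞) × ℝ → ℂ be such that η ↦ F(η,·) is continuously differentiable as a map into L²(ℝ), ‖F(η,·)‖_{L²(ℝ)} → 0 as η → ∞, and ‖∂_ηF‖_Y < ∞. Assume there exist E₁, E₂ with ‖E₁‖_X < ∞ and ‖E₂‖_X < ∞ such that F(η,y) = η^{−α} E₁(η,y) and ∂_ηF(η,y) = η^{−α−1} E₂(η,y) for all η ∈ (0,δ₀) and y ∈ ℝ. Then there exists a constant C > 0 depending only on α such that ‖∫₀^∞ e^{imηt} F(η,·) dη‖_{L²(ℝ)} ≤ C [ (mt)^{α−1} (‖E₁‖_X + ‖E₂‖_X) + (mt)^{−1} ‖∂_ηF‖_Y ]. -/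
open MeasureTheory Complex Set Filter
open scoped ENNReal Real

noncomputable section

section Oscillatory

lemma norm_exp_I_mul_ofReal_mul (l η : ℝ) : ‖exp (I * l * η)‖ = 1 := by
  rw [show I * (l : ℂ) * η = ((l * η : ℝ) : ℂ) * I by push_cast; ring]
  exact norm_exp_ofReal_mul_I _

lemma continuous_exp_I_mul_ofReal_mul (l : ℝ) : Continuous fun η : ℝ => exp (I * l * η) := by
  fun_prop

lemma hasDerivAt_exp_I_mul_ofReal_mul (l η : ℝ) :
    HasDerivAt (fun η : ℝ => exp (I * l * η)) (I * l * exp (I * l * η)) η := by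
  have h : HasDerivAt (fun η : ℝ => I * (l : ℂ) * (η : ℂ)) (I * l) η := by
    simpa using (hasDerivAt_id η).ofReal_comp.const_mul (I * (l : ℂ))
  simpa [mul_comm] using h.cexp

variable {E : Type*} [NormedAddCommGroup E]

/-- An amplitude with an integrable power singularity at the origin is integrable there, with the
expected bound. -/
lemma intervalIntegrable_and_norm_integral_le_rpow [NormedSpace ℝ E] {α ε N : ℝ} (hα : α < 1)
    (hε : 0 < ε) {G : ℝ → E} (hG : ContinuousOn G (Ioc 0 ε))
    (hN : ∀ η ∈ Ioc 0 ε, ‖G η‖ ≤ N * η ^ (-α)) :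
    IntervalIntegrable G volume 0 ε ∧
      ‖∫ η in (0 : ℝ)..ε, G η‖ ≤ N * (ε ^ (1 - α) / (1 - α)) := by
  have hpow : IntervalIntegrable (fun η : ℝ => N * η ^ (-α)) volume 0 ε :=
    (intervalIntegral.intervalIntegrable_rpow' (by linarith)).const_mul N
  have hae : ∀ᵐ η ∂volume.restrict (Ioc 0 ε), ‖G η‖ ≤ N * η ^ (-α) :=
    (ae_restrict_iff' measurableSet_Ioc).2 (ae_of_all _ hN)
  refine ⟨?_, ?_⟩
  · rw [intervalIntegrable_iff_integrableOn_Ioc_of_le hε.le] at hpow ⊢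
    exact Integrable.mono' hpow (hG.aestronglyMeasurable measurableSet_Ioc) hae
  · refine (intervalIntegral.norm_integral_le_of_norm_le hε.le
      (ae_of_all _ hN) hpow).trans_eq ?_
    rw [intervalIntegral.integral_const_mul, integral_rpow (Or.inl (by linarith)),
      Real.zero_rpow (by linarith), sub_zero, show -α + 1 = 1 - α by ring]

/-- A tail bound for a function with a power singularity on `(0, δ)`. -/
lemma integral_norm_Ioi_le_of_rpow {α ε δ N : ℝ} (hα : 0 < α) (hε : 0 < ε) (hεδ : ε < δ)
    (hN0 : 0 ≤ N) {G : ℝ → E} (hG : ContinuousOn G (Ioi 0)) (hGi : IntegrableOn G (Ioi δ))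
    (hN : ∀ η ∈ Ioo 0 δ, ‖G η‖ ≤ N * η ^ (-α - 1)) :
    IntegrableOn G (Ioi ε) ∧
      ∫ η in Ioi ε, ‖G η‖ ≤ N * (ε ^ (-α) / α) + ∫ η in Ioi δ, ‖G η‖ := by
  have hc : ContinuousOn G (Icc ε δ) := hG.mono fun x hx => hε.trans_le hx.1
  have h1 : IntegrableOn G (Ioc ε δ) :=
    (hc.integrableOn_compact isCompact_Icc).mono_set Ioc_subset_Icc_self
  have h0 : (0 : ℝ) ∉ uIcc ε δ := by
    rw [uIcc_of_le hεδ.le]; exact fun h => hε.not_ge h.1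
  have hpow : IntervalIntegrable (fun η : ℝ => N * η ^ (-α - 1)) volume ε δ :=
    (intervalIntegral.intervalIntegrable_rpow (Or.inr h0)).const_mul N
  rw [← Ioc_union_Ioi_eq_Ioi hεδ.le]
  refine ⟨h1.union hGi, ?_⟩
  rw [setIntegral_union (Ioc_disjoint_Ioi le_rfl) measurableSet_Ioi h1.norm hGi.norm]
  gcongr
  rw [← intervalIntegral.integral_of_le hεδ.le]
  calc ∫ η in ε..δ, ‖G η‖ ≤ ∫ η in ε..δ, N * η ^ (-α - 1) :=
        intervalIntegral.integral_mono_on_of_le_Ioo hεδ.le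
          ((intervalIntegrable_iff_integrableOn_Ioc_of_le hεδ.le).2 h1.norm) hpow
          fun x hx => hN x ⟨hε.trans hx.1, hx.2⟩
    _ = N * ((ε ^ (-α) - δ ^ (-α)) / α) := by
        rw [intervalIntegral.integral_const_mul, integral_rpow (Or.inr ⟨by linarith, h0⟩),
          show -α - 1 + 1 = -α by ring, ← neg_div_neg_eq, neg_neg, neg_sub]
    _ ≤ N * (ε ^ (-α) / α) := by
        gcongr
        exact sub_le_self _ (Real.rpow_nonneg (hε.trans hεδ).le _)

variable [NormedSpace ℝ E] [NormedSpace ℂ E] [IsScalarTower ℝ ℂ E]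

/-- Integration by parts against the oscillating factor `exp (i l η)`. -/
lemma integral_exp_smul_eq [CompleteSpace E] {l a b : ℝ} (hl : l ≠ 0) (hab : a ≤ b) {F F' : ℝ → E}
    (hF : ∀ η ∈ Icc a b, HasDerivAt F (F' η) η) (hF' : ContinuousOn F' (Icc a b)) :
    ∫ η in a..b, exp (I * l * η) • F η =
      (I * l)⁻¹ • (exp (I * l * b) • F b - exp (I * l * a) • F a
        - ∫ η in a..b, exp (I * l * η) • F' η) := by
  have hIl : I * (l : ℂ) ≠ 0 := mul_ne_zero I_ne_zero (by exact_mod_cast hl)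
  have he := continuous_exp_I_mul_ofReal_mul l
  have hFc : ContinuousOn F (Icc a b) := fun x hx => (hF x hx).continuousAt.continuousWithinAt
  have i1 : IntervalIntegrable (fun η => exp (I * l * η) • F η) volume a b := by
    apply ContinuousOn.intervalIntegrable
    rw [uIcc_of_le hab]
    exact he.continuousOn.smul hFc
  have i3 : IntervalIntegrable (fun η => (I * (l : ℂ)) • (exp (I * l * η) • F η)) volume a b :=
    i1.smul (I * (l : ℂ))
  have i2 : IntervalIntegrable (fun η => exp (I * l * η) • F' η) volume a b := by
    apply ContinuousOn.intervalIntegrable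
    rw [uIcc_of_le hab]
    exact he.continuousOn.smul hF'
  have ftc := intervalIntegral.integral_eq_sub_of_hasDerivAt
    (f := fun η => exp (I * l * η) • F η)
    (f' := fun η => exp (I * l * η) • F' η + (I * (l : ℂ)) • (exp (I * l * η) • F η))
    (a := a) (b := b)
    (fun x hx => by
      rw [uIcc_of_le hab] at hx
      rw [smul_smul]
      exact (hasDerivAt_exp_I_mul_ofReal_mul l x).smul (hF x hx))
    (i2.add i3)
  rw [intervalIntegral.integral_add i2 i3,
    intervalIntegral.integral_smul] at ftc
  rw [← ftc, add_sub_cancel_left, smul_smul, inv_mul_cancel₀ hIl, one_smul]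

/-- Stationary-phase estimate obtained by splitting the integral at an arbitrary point `ε`. -/
lemma exists_tendsto_integral_exp_smul_norm_le [CompleteSpace E] {α l ε δ N₁ N₂ : ℝ}
    (hα : α ∈ Ioo (0 : ℝ) 1) (hl : 0 < l) (hε : 0 < ε) (hεδ : ε < δ) (hN₂ : 0 ≤ N₂)
    {F F' : ℝ → E} (hF : ∀ η ∈ Ioi (0 : ℝ), HasDerivAt F (F' η) η)
    (hF' : ContinuousOn F' (Ioi 0)) (hlim : Tendsto (fun η => ‖F η‖) atTop (nhds 0))
    (hint : IntegrableOn F' (Ioi δ)) (h₁ : ∀ η ∈ Ioo 0 δ, ‖F η‖ ≤ N₁ * η ^ (-α))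
    (h₂ : ∀ η ∈ Ioo 0 δ, ‖F' η‖ ≤ N₂ * η ^ (-α - 1)) :
    ∃ L : E, Tendsto (fun b : ℝ => ∫ η in (0 : ℝ)..b, exp (I * l * η) • F η) atTop (nhds L) ∧
      ‖L‖ ≤ N₁ * (ε ^ (1 - α) / (1 - α)) +
        l⁻¹ * (N₁ * ε ^ (-α) + (N₂ * (ε ^ (-α) / α) + ∫ η in Ioi δ, ‖F' η‖)) := by
  have he := continuous_exp_I_mul_ofReal_mul l
  have hFc : ContinuousOn F (Ioi 0) := fun x hx => (hF x hx).continuousAt.continuousWithinAt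
  have hnorm (G : ℝ → E) (η : ℝ) : ‖exp (I * l * η) • G η‖ = ‖G η‖ := by
    rw [norm_smul, norm_exp_I_mul_ofReal_mul, one_mul]
  obtain ⟨hi0, hb0⟩ := intervalIntegrable_and_norm_integral_le_rpow hα.2 hε
    (G := fun η => exp (I * l * η) • F η)
    (he.continuousOn.smul (hFc.mono fun x hx => hx.1))
    (fun η hη => (hnorm F η).trans_le (h₁ η ⟨hη.1, hη.2.trans_lt hεδ⟩))
  obtain ⟨hi1, hb1⟩ := integral_norm_Ioi_le_of_rpow hα.1 hε hεδ hN₂ hF' hint h₂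
  have hi2 : IntegrableOn (fun η : ℝ => exp (I * l * η) • F' η) (Ioi ε) :=
    Integrable.mono hi1 (he.aestronglyMeasurable.smul hi1.aestronglyMeasurable)
      (ae_of_all _ fun η => (hnorm F' η).le)
  refine ⟨(∫ η in (0 : ℝ)..ε, exp (I * l * η) • F η) + (I * (l : ℂ))⁻¹ •
    (0 - exp (I * l * ε) • F ε - ∫ η in Ioi ε, exp (I * l * η) • F' η), ?_, ?_⟩
  · have hb : Tendsto (fun b : ℝ => exp (I * l * b) • F b) atTop (nhds 0) :=
      tendsto_zero_iff_norm_tendsto_zero.2 (by simpa only [hnorm] using hlim)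
    have hlimint := intervalIntegral_tendsto_integral_Ioi ε hi2 tendsto_id
    refine Tendsto.congr' ?_ (tendsto_const_nhds.add
      (((hb.sub tendsto_const_nhds).sub hlimint).const_smul _))
    filter_upwards [eventually_ge_atTop ε] with b hεb
    have hsub : Icc ε b ⊆ Ioi 0 := fun x hx => hε.trans_le hx.1
    rw [id, ← integral_exp_smul_eq hl.ne' hεb (fun η hη => hF η (hsub hη)) (hF'.mono hsub)]
    refine intervalIntegral.integral_add_adjacent_intervals hi0 ?_
    apply ContinuousOn.intervalIntegrable
    rw [uIcc_of_le hεb]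
    exact he.continuousOn.smul (hFc.mono hsub)
  · refine (norm_add_le _ _).trans (add_le_add hb0 ?_)
    have hc : ‖(I * (l : ℂ))⁻¹‖ = l⁻¹ := by simp [abs_of_pos hl]
    rw [norm_smul, hc, zero_sub]
    gcongr
    refine (norm_sub_le _ _).trans (add_le_add ?_ ?_)
    · rw [norm_neg, hnorm]
      exact h₁ ε ⟨hε, hεδ⟩
    · refine (norm_integral_le_integral_norm _).trans ?_
      simpa only [hnorm] using hb1

end Oscillatory

/-- Lemma 4.2(i): stationary-phase decay for oscillatory integrals whose
amplitude `F` (a C¹ curve in `L²(ℝ)` vanishing at infinity) has a power-type singularity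
`F(η) = η^{−α} E₁(η)`, `∂_ηF(η) = η^{−α−1} E₂(η)` on `(0, δ₀)`, `δ₀ = 1/(2m)`. The
(improper) integral `∫₀^∞ e^{imηt} F(η) dη` has `L²` norm at most
`C [(mt)^{α−1}(‖E₁‖_X + ‖E₂‖_X) + (mt)^{−1} ‖∂_ηF‖_Y]`, with `C` depending only on `α`. -/
theorem stationary_phase_power_singularity (α : ℝ) (hα : α ∈ Set.Ioo (0 : ℝ) 1) :
    ∃ C : ℝ, 0 < C ∧
      ∀ (m : ℕ), 1 ≤ m → ∀ δ₀ : ℝ, δ₀ = 1 / (2 * (m : ℝ)) → ∀ t : ℝ, 1 ≤ t →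
      ∀ (F F' : ℝ → Lp ℂ 2 (volume : Measure ℝ)),
        (∀ η ∈ Set.Ioi (0 : ℝ), HasDerivAt F (F' η) η) →
        ContinuousOn F' (Set.Ioi (0 : ℝ)) →
        Filter.Tendsto (fun η => ‖F η‖) Filter.atTop (nhds 0) →
        IntegrableOn F' (Set.Ioi δ₀) →
      ∀ (E₁ E₂ : ℝ → Lp ℂ 2 (volume : Measure ℝ)) (N₁ N₂ : ℝ),
        (∀ η ∈ Set.Ioo (0 : ℝ) δ₀, F η = (η ^ (-α) : ℝ) • E₁ η) →
        (∀ η ∈ Set.Ioo (0 : ℝ) δ₀, F' η = (η ^ (-α - 1) : ℝ) • E₂ η) →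
        (∀ η ∈ Set.Ioo (0 : ℝ) δ₀, ‖E₁ η‖ ≤ N₁) →
        (∀ η ∈ Set.Ioo (0 : ℝ) δ₀, ‖E₂ η‖ ≤ N₂) →
      ∃ L : Lp ℂ 2 (volume : Measure ℝ),
        Filter.Tendsto
          (fun b => ∫ η in (0 : ℝ)..b, Complex.exp (Complex.I * m * η * t) • F η)
          Filter.atTop (nhds L) ∧
        ‖L‖ ≤ C * (((m : ℝ) * t) ^ (α - 1) * (N₁ + N₂)
          + ((m : ℝ) * t)⁻¹ * ∫ η in Set.Ioi δ₀, ‖F' η‖) := by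
  obtain ⟨hα0, hα1⟩ := hα
  have hα' : 0 < 1 - α := sub_pos.2 hα1
  refine ⟨1 / (1 - α) + 4 + 4 / α, by positivity, ?_⟩
  intro m hm δ₀ hδ t ht F F' hF hF' hlim hint E₁ E₂ N₁ N₂ hFE hFE' hE₁ hE₂
  have hm0 : (0 : ℝ) < m := by exact_mod_cast hm
  have ht0 : 0 < t := one_pos.trans_le ht
  set l : ℝ := m * t with hl_def
  have hl : 0 < l := mul_pos hm0 ht0
  have hε : 0 < (4 * l)⁻¹ := by positivity
  have hεδ : (4 * l)⁻¹ < δ₀ := by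
    rw [hδ, one_div]
    exact inv_strictAnti₀ (by positivity) (by nlinarith)
  have hN₁ : 0 ≤ N₁ := (norm_nonneg _).trans (hE₁ _ ⟨hε, hεδ⟩)
  have hN₂ : 0 ≤ N₂ := (norm_nonneg _).trans (hE₂ _ ⟨hε, hεδ⟩)
  have h₁ : ∀ η ∈ Ioo 0 δ₀, ‖F η‖ ≤ N₁ * η ^ (-α) := fun η hη => by
    have hp := Real.rpow_nonneg hη.1.le (-α)
    rw [hFE η hη, norm_smul, Real.norm_of_nonneg hp, mul_comm]
    exact mul_le_mul_of_nonneg_right (hE₁ η hη) hp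
  have h₂ : ∀ η ∈ Ioo 0 δ₀, ‖F' η‖ ≤ N₂ * η ^ (-α - 1) := fun η hη => by
    have hp := Real.rpow_nonneg hη.1.le (-α - 1)
    rw [hFE' η hη, norm_smul, Real.norm_of_nonneg hp, mul_comm]
    exact mul_le_mul_of_nonneg_right (hE₂ η hη) hp
  obtain ⟨L, hL, hLn⟩ := exists_tendsto_integral_exp_smul_norm_le ⟨hα0, hα1⟩ hl hε hεδ hN₂
    hF hF' hlim hint h₁ h₂
  refine ⟨L, ?_, hLn.trans ?_⟩
  · convert hL using 6
    rw [hl_def]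
    push_cast
    ring
  set J := ∫ η in Ioi δ₀, ‖F' η‖
  have hJ : 0 ≤ J := integral_nonneg fun _ => norm_nonneg _
  have hP : 0 ≤ l ^ (α - 1) := Real.rpow_nonneg hl.le _
  have p1 : ((4 * l)⁻¹) ^ (1 - α) ≤ l ^ (α - 1) := by
    rw [Real.inv_rpow (by positivity), ← Real.rpow_neg (by positivity), neg_sub]
    exact Real.rpow_le_rpow_of_nonpos hl (by linarith) (by linarith)
  have p2 : l⁻¹ * ((4 * l)⁻¹) ^ (-α) ≤ 4 * l ^ (α - 1) := by
    rw [Real.inv_rpow (by positivity), ← Real.rpow_neg (by positivity), neg_neg,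
      Real.mul_rpow (by norm_num) hl.le, Real.rpow_sub_one hl.ne', div_eq_mul_inv]
    have h4 : (4 : ℝ) ^ α ≤ 4 := by
      simpa using Real.rpow_le_rpow_of_exponent_le (by norm_num : (1 : ℝ) ≤ 4) hα1.le
    have hq : 0 ≤ l ^ α * l⁻¹ := by positivity
    nlinarith
  calc N₁ * ((4 * l)⁻¹ ^ (1 - α) / (1 - α)) +
        l⁻¹ * (N₁ * (4 * l)⁻¹ ^ (-α) + (N₂ * ((4 * l)⁻¹ ^ (-α) / α) + J))
      = N₁ * ((4 * l)⁻¹ ^ (1 - α) / (1 - α)) + N₁ * (l⁻¹ * (4 * l)⁻¹ ^ (-α))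
        + N₂ * ((l⁻¹ * (4 * l)⁻¹ ^ (-α)) / α) + l⁻¹ * J := by ring
    _ ≤ N₁ * (l ^ (α - 1) / (1 - α)) + N₁ * (4 * l ^ (α - 1))
        + N₂ * ((4 * l ^ (α - 1)) / α) + l⁻¹ * J := by gcongr
    _ = (1 / (1 - α) + 4) * (l ^ (α - 1) * N₁) + 4 / α * (l ^ (α - 1) * N₂)
        + 1 * (l⁻¹ * J) := by ring
    _ ≤ (1 / (1 - α) + 4 + 4 / α) * (l ^ (α - 1) * N₁)
        + (1 / (1 - α) + 4 + 4 / α) * (l ^ (α - 1) * N₂)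
        + (1 / (1 - α) + 4 + 4 / α) * (l⁻¹ * J) := by
      have q1 : 0 ≤ 1 / (1 - α) := by positivity
      have q2 : 0 ≤ 4 / α := by positivity
      refine add_le_add (add_le_add ?_ ?_) ?_ <;>
        exact mul_le_mul_of_nonneg_right (by linarith) (by positivity)
    _ = _ := by ring
end
end

section
/- Let 0 < α < 1, let m ≥ 1 be an integer, set δ₀ = 1/(2m), and let t ≥ 1. Let F : (0,∞) × ℝ → ℂ be such that η ↦ F(η,·) is continuously differentiable as a map into L²(ℝ), ‖F(η,·)‖_{L²(ℝ)} → 0 as η → ∞, and ‖∂_ηF‖_Y < ∞. Assume there exist E_{1,1}, E_{1,2}, E_{2,1}, E_{2,2}, each with finite ‖·‖_X norm, such that F(η,y) = η^{−α} (E_{1,1}(η,y) + log(η) E_{1,2}(η,y)) and ∂_ηF(η,y) = η^{−α−1} (E_{2,1}(η,y) + log(η) E_{2,2}(η,y)) for all η ∈ (0,δ₀) and y ∈ ℝ. Then there exists a constant C > 0 depending only on α such that ‖∫₀^∞ e^{imηt} F(η,·) dη‖_{L²(ℝ)} ≤ C [ (1 + log(mt)) (mt)^{α−1} (‖E_{1,1}‖_X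 + ‖E_{1,2}‖_X + ‖E_{2,1}‖_X + ‖E_{2,2}‖_X) + (mt)^{−1} ‖∂_ηF‖_Y ]. -/
open MeasureTheory Complex Set Filter
open scoped ENNReal Real

noncomputable section

/-- Comparison of `-log` at two points, with a power loss. -/
lemma neg_log_le_neg_log_add_rpow {η ε s : ℝ} (hη : 0 < η) (hε : 0 < ε) (hs : 0 < s) :
    -Real.log η ≤ -Real.log ε + ε ^ s / s * η ^ (-s) := by
  have h := Real.log_le_rpow_div (div_pos hε hη).le hs
  rw [Real.log_div hε.ne' hη.ne', Real.div_rpow hε.le hη.le] at h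
  rw [Real.rpow_neg hη.le]
  have : ε ^ s / s * (η ^ s)⁻¹ = ε ^ s / η ^ s / s := by ring
  linarith

lemma one_sub_log_pos {ε : ℝ} (hε : 0 < ε) (hε1 : ε < 1) : 0 < 1 - Real.log ε := by
  have := Real.log_neg hε hε1
  linarith

section Oscillatory

variable {E : Type*} [NormedAddCommGroup E]

lemma integral_rpow_neg_sub_one_le {α ε δ : ℝ} (hα : 0 < α) (hε : 0 < ε) (hεδ : ε ≤ δ) :
    ∫ η in ε..δ, η ^ (-α - 1) ≤ ε ^ (-α) / α := by
  have h0 : (0 : ℝ) ∉ uIcc ε δ := by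
    rw [uIcc_of_le hεδ]; exact fun h => absurd h.1 (not_le.2 hε)
  rw [integral_rpow (Or.inr ⟨by linarith, h0⟩), sub_add_cancel, div_neg, ← neg_div]
  have := Real.rpow_nonneg (hε.le.trans hεδ) (-α)
  gcongr
  linarith

/-- Away from the origin, the singular bound on the derivative costs `ε ^ (-α) (1 - log ε)`. -/
lemma integral_Ioi_norm_le_of_log_singularity
    {α ε δ N : ℝ} (hα : 0 < α) (hε : 0 < ε) (hεδ : ε < δ) (hδ1 : δ < 1) (hN : 0 ≤ N) {f : ℝ → E}
    (hf : ContinuousOn f (Ioi 0)) (hfi : IntegrableOn f (Ioi δ))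
    (hb : ∀ η ∈ Ioo 0 δ, ‖f η‖ ≤ η ^ (-α - 1) * (1 - Real.log η) * N) :
    IntegrableOn f (Ioi ε) ∧
      ∫ η in Ioi ε, ‖f η‖ ≤
        1 / α * (ε ^ (-α) * (1 - Real.log ε)) * N + ∫ η in Ioi δ, ‖f η‖ := by
  have hQ := one_sub_log_pos hε (hεδ.trans hδ1)
  have h0 : (0 : ℝ) ∉ uIcc ε δ := by
    rw [uIcc_of_le hεδ.le]; exact fun h => absurd h.1 (not_le.2 hε)
  have hfc : IntervalIntegrable f volume ε δ := by
    refine (hf.mono ?_).intervalIntegrable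
    rw [uIcc_of_le hεδ.le]
    exact fun x hx => hε.trans_le hx.1
  have hfI : IntegrableOn f (Ioc ε δ) :=
    (intervalIntegrable_iff_integrableOn_Ioc_of_le hεδ.le).1 hfc
  refine ⟨by rw [← Ioc_union_Ioi_eq_Ioi hεδ.le]; exact hfI.union hfi, ?_⟩
  rw [← Ioc_union_Ioi_eq_Ioi hεδ.le,
    setIntegral_union (Ioc_disjoint_Ioi le_rfl) measurableSet_Ioi hfI.norm hfi.norm,
    ← intervalIntegral.integral_of_le hεδ.le]
  gcongr
  have hi : IntervalIntegrable (fun η : ℝ => η ^ (-α - 1) * ((1 - Real.log ε) * N)) volume ε δ :=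
    (intervalIntegral.intervalIntegrable_rpow (Or.inr h0)).mul_const _
  calc ∫ η in ε..δ, ‖f η‖
      ≤ ∫ η in ε..δ, η ^ (-α - 1) * ((1 - Real.log ε) * N) := by
        refine intervalIntegral.integral_mono_on_of_le_Ioo hεδ.le hfc.norm hi ?_
        intro η hη
        have hη0 := hε.trans hη.1
        refine (hb η ⟨hη0, hη.2⟩).trans ?_
        rw [mul_assoc]
        have := Real.rpow_nonneg hη0.le (-α - 1)
        have := Real.log_le_log hε hη.1.le
        gcongr
    _ ≤ ε ^ (-α) / α * ((1 - Real.log ε) * N) := by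
        rw [intervalIntegral.integral_mul_const]
        gcongr
        exact integral_rpow_neg_sub_one_le hα hε hεδ.le
    _ = 1 / α * (ε ^ (-α) * (1 - Real.log ε)) * N := by ring

variable [NormedSpace ℝ E]

/-- An `η ^ (-α) (1 - log η)` singularity at the origin is integrable, with an explicit bound. -/
lemma intervalIntegrable_and_norm_integral_le_of_log_singularity
    {α ε N : ℝ} (hα : α < 1) (hε : 0 < ε) (hε1 : ε < 1) (hN : 0 ≤ N) {f : ℝ → E}
    (hf : ContinuousOn f (Ioi 0))
    (hb : ∀ η ∈ Ioc 0 ε, ‖f η‖ ≤ η ^ (-α) * (1 - Real.log η) * N) :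
    IntervalIntegrable f volume 0 ε ∧
      ‖∫ η in (0 : ℝ)..ε, f η‖ ≤
        (1 / (1 - α) + 1 / ((1 - α) / 2) ^ 2) * (ε ^ (1 - α) * (1 - Real.log ε)) * N := by
  have hs0 : 0 < (1 - α) / 2 := by linarith
  set s := (1 - α) / 2 with hs
  have hQ := one_sub_log_pos hε hε1
  set Q := 1 - Real.log ε with hQdef
  have hQ1 : 1 ≤ Q := by
    have := Real.log_neg hε hε1
    linarith
  let g : ℝ → ℝ := fun η => (Q * N) * η ^ (-α) + (ε ^ s / s * N) * η ^ (-α - s)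
  have hi1 : IntervalIntegrable (fun η : ℝ => η ^ (-α)) volume 0 ε :=
    intervalIntegral.intervalIntegrable_rpow' (by linarith)
  have hi2 : IntervalIntegrable (fun η : ℝ => η ^ (-α - s)) volume 0 ε :=
    intervalIntegral.intervalIntegrable_rpow' (by linarith)
  have hg : IntervalIntegrable g volume 0 ε := (hi1.const_mul _).add (hi2.const_mul _)
  have hle : ∀ η ∈ Ioc 0 ε, ‖f η‖ ≤ g η := by
    intro η hη
    refine (hb η hη).trans ?_
    have h1 := neg_log_le_neg_log_add_rpow hη.1 hε hs0
    have h2 : 0 ≤ η ^ (-α) := Real.rpow_nonneg hη.1.le _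
    have h3 : η ^ (-α - s) = η ^ (-α) * η ^ (-s) := by
      rw [← Real.rpow_add hη.1]; congr 1
    calc η ^ (-α) * (1 - Real.log η) * N
        ≤ η ^ (-α) * (Q + ε ^ s / s * η ^ (-s)) * N := by
          gcongr
          linarith
      _ = g η := by
          simp only [g, h3]
          ring
  have hae : ∀ᵐ η ∂volume, η ∈ Ioc 0 ε → ‖f η‖ ≤ g η := Eventually.of_forall hle
  have hmeas : AEStronglyMeasurable f (volume.restrict (Ioc 0 ε)) :=
    (hf.mono fun x hx => hx.1).aestronglyMeasurable measurableSet_Ioc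
  refine ⟨?_, (intervalIntegral.norm_integral_le_of_norm_le hε.le hae hg).trans ?_⟩
  · rw [intervalIntegrable_iff_integrableOn_Ioc_of_le hε.le] at hg ⊢
    exact Integrable.mono' hg hmeas ((ae_restrict_iff' measurableSet_Ioc).2 hae)
  · have hint : ∫ η in (0 : ℝ)..ε, g η
        = (Q * N) * (ε ^ (1 - α) / (1 - α)) + (ε ^ s / s * N) * (ε ^ s / s) := by
      simp only [g]
      rw [intervalIntegral.integral_add (hi1.const_mul _) (hi2.const_mul _),
        intervalIntegral.integral_const_mul, intervalIntegral.integral_const_mul,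
        integral_rpow (Or.inl (by linarith)), integral_rpow (Or.inl (by linarith)),
        show -α + 1 = 1 - α by ring, show -α - s + 1 = s by rw [hs]; ring,
        Real.zero_rpow (by linarith), Real.zero_rpow hs0.ne', sub_zero, sub_zero]
    have hpow : ε ^ (1 - α) = ε ^ s * ε ^ s := by
      rw [← Real.rpow_add hε]; congr 1; rw [hs]; ring
    rw [hint]
    have h4 : (ε ^ s / s * N) * (ε ^ s / s) = 1 / s ^ 2 * (ε ^ (1 - α) * 1) * N := by
      rw [hpow]; field_simp
    have h5 : 1 / s ^ 2 * (ε ^ (1 - α) * 1) * N ≤ 1 / s ^ 2 * (ε ^ (1 - α) * Q) * N := by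
      gcongr
    have h6 : (1 / (1 - α) + 1 / s ^ 2) * (ε ^ (1 - α) * Q) * N
        = (Q * N) * (ε ^ (1 - α) / (1 - α)) + 1 / s ^ 2 * (ε ^ (1 - α) * Q) * N := by ring
    linarith

lemma norm_rpow_smul_add_log_smul_le {β η N A B : ℝ} (hη : 0 < η) (hη1 : η < 1) {x y : E}
    (hx : ‖x‖ ≤ A) (hy : ‖y‖ ≤ B) (hAB : A + B ≤ N) :
    ‖(η ^ β : ℝ) • (x + Real.log η • y)‖ ≤ η ^ β * (1 - Real.log η) * N := by
  have hlog := Real.log_neg hη hη1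
  have hp := Real.rpow_nonneg hη.le β
  rw [norm_smul, Real.norm_of_nonneg hp, mul_assoc]
  gcongr
  refine (norm_add_le _ _).trans ?_
  rw [norm_smul, Real.norm_of_nonpos hlog.le]
  have hA := (norm_nonneg x).trans hx
  have hB := (norm_nonneg y).trans hy
  nlinarith [mul_le_mul_of_nonneg_left hy (neg_nonneg.2 hlog.le)]

variable [NormedSpace ℂ E] [IsScalarTower ℝ ℂ E]

lemma norm_exp_I_mul_mul (l η : ℝ) : ‖Complex.exp (Complex.I * l * η)‖ = 1 := by
  rw [show Complex.I * l * η = ((l * η : ℝ) : ℂ) * Complex.I by push_cast; ring,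
    Complex.norm_exp_ofReal_mul_I]

lemma hasDerivAt_exp_I_mul_mul (l η : ℝ) :
    HasDerivAt (fun η : ℝ => Complex.exp (Complex.I * l * η))
      (Complex.I * l * Complex.exp (Complex.I * l * η)) η := by
  have h := ((hasDerivAt_id (η : ℂ)).const_mul (Complex.I * l)).cexp.comp_ofReal
  simpa [mul_comm] using h

/-- Integration by parts for an oscillatory integral whose amplitude vanishes at infinity. -/
lemma exists_tendsto_oscillatory_integral [CompleteSpace E] {l ε : ℝ} (hl : 0 < l) (hε : 0 < ε)
    {F F' : ℝ → E} (hF : ∀ η ∈ Ioi (0 : ℝ), HasDerivAt F (F' η) η)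
    (hF' : ContinuousOn F' (Ioi 0)) (hlim : Tendsto (fun η => ‖F η‖) atTop (nhds 0))
    (hi : IntegrableOn F' (Ioi ε)) :
    ∃ L : E, Tendsto (fun b => ∫ η in ε..b, Complex.exp (Complex.I * l * η) • F η) atTop (nhds L) ∧
      ‖L‖ ≤ l⁻¹ * (‖F ε‖ + ∫ η in Ioi ε, ‖F' η‖) := by
  set e : ℝ → ℂ := fun η => Complex.exp (Complex.I * l * η) with he
  have hec : Continuous e := by fun_prop
  have hen : ∀ η, ‖e η‖ = 1 := norm_exp_I_mul_mul l
  have hc0 : Complex.I * l ≠ 0 := by simp [hl.ne']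
  have hcn : ‖(Complex.I * l)⁻¹‖ = l⁻¹ := by simp [abs_of_pos hl]
  have hFc : ContinuousOn F (Ioi 0) := fun η hη => (hF η hη).continuousAt.continuousWithinAt
  have hei : IntegrableOn (fun η => e η • F' η) (Ioi ε) := by
    refine Integrable.mono hi ?_ (Eventually.of_forall fun η => by rw [norm_smul, hen, one_mul])
    exact hec.aestronglyMeasurable.smul hi.aestronglyMeasurable
  have hparts : ∀ b, ε ≤ b → ∫ η in ε..b, e η • F η =
      (Complex.I * l)⁻¹ • (e b • F b - e ε • F ε - ∫ η in ε..b, e η • F' η) := by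
    intro b hb
    have hsub : uIcc ε b ⊆ Ioi 0 := by
      rw [uIcc_of_le hb]
      exact fun x hx => hε.trans_le hx.1
    have h1 : IntervalIntegrable (fun η => e η • F η) volume ε b :=
      (hec.continuousOn.smul (hFc.mono hsub)).intervalIntegrable
    have h2 : IntervalIntegrable (fun η => e η • F' η) volume ε b :=
      (hec.continuousOn.smul (hF'.mono hsub)).intervalIntegrable
    have h1' : IntervalIntegrable (fun η => (Complex.I * l * e η) • F η) volume ε b :=
      ((continuous_const.mul hec).continuousOn.smul (hFc.mono hsub)).intervalIntegrable
    have hd : ∀ η ∈ uIcc ε b, HasDerivAt (fun η => e η • F η)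
        (e η • F' η + (Complex.I * l * e η) • F η) η := fun η hη =>
      (hasDerivAt_exp_I_mul_mul l η).smul (hF η (hsub hη))
    have h3 := intervalIntegral.integral_eq_sub_of_hasDerivAt hd (h2.add h1')
    rw [intervalIntegral.integral_add h2 h1'] at h3
    simp_rw [mul_smul _ (e _)] at h3
    rw [intervalIntegral.integral_smul] at h3
    rw [← h3, add_sub_cancel_left, inv_smul_smul₀ hc0]
  refine ⟨(Complex.I * l)⁻¹ • (0 - e ε • F ε - ∫ η in Ioi ε, e η • F' η), ?_, ?_⟩
  · have hz : Tendsto (fun b => e b • F b) atTop (nhds 0) := by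
      rw [tendsto_zero_iff_norm_tendsto_zero]
      simpa [norm_smul, hen] using hlim
    refine Tendsto.congr' ?_ (((hz.sub_const _).sub
      (intervalIntegral_tendsto_integral_Ioi ε hei tendsto_id)).const_smul _)
    filter_upwards [eventually_ge_atTop ε] with b hb
    exact (hparts b hb).symm
  · rw [norm_smul, hcn, zero_sub]
    gcongr
    refine (norm_sub_le _ _).trans (add_le_add ?_ ((norm_integral_le_integral_norm _).trans ?_))
    · rw [norm_neg, norm_smul, hen, one_mul]
    · simp_rw [norm_smul, hen, one_mul]
      exact le_rfl

/-- Splitting the oscillatory integral at `ε`, for a power-times-logarithm singularity. -/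
lemma exists_tendsto_oscillatory_integral_of_log_singularity [CompleteSpace E]
    {α l ε δ N : ℝ} (hα0 : 0 < α) (hα1 : α < 1) (hl : 0 < l) (hε : 0 < ε) (hεδ : ε < δ)
    (hδ1 : δ < 1) (hN : 0 ≤ N) {F F' : ℝ → E}
    (hF : ∀ η ∈ Ioi (0 : ℝ), HasDerivAt F (F' η) η)
    (hF' : ContinuousOn F' (Ioi 0)) (hlim : Tendsto (fun η => ‖F η‖) atTop (nhds 0))
    (hi : IntegrableOn F' (Ioi δ))
    (hb : ∀ η ∈ Ioo 0 δ, ‖F η‖ ≤ η ^ (-α) * (1 - Real.log η) * N)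
    (hb' : ∀ η ∈ Ioo 0 δ, ‖F' η‖ ≤ η ^ (-α - 1) * (1 - Real.log η) * N) :
    ∃ L : E,
      Tendsto (fun b => ∫ η in (0 : ℝ)..b, Complex.exp (Complex.I * l * η) • F η)
        atTop (nhds L) ∧
      ‖L‖ ≤ (1 / (1 - α) + 1 / ((1 - α) / 2) ^ 2) * (ε ^ (1 - α) * (1 - Real.log ε)) * N
        + l⁻¹ * (ε ^ (-α) * (1 - Real.log ε) * N
          + (1 / α * (ε ^ (-α) * (1 - Real.log ε)) * N + ∫ η in Ioi δ, ‖F' η‖)) := by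
  have hFc : ContinuousOn (fun η : ℝ => Complex.exp (Complex.I * l * η) • F η) (Ioi 0) :=
    (by fun_prop : Continuous fun η : ℝ => Complex.exp (Complex.I * l * η)).continuousOn.smul
      fun η hη => (hF η hη).continuousAt.continuousWithinAt
  obtain ⟨hint, hnear⟩ := intervalIntegrable_and_norm_integral_le_of_log_singularity hα1 hε
    (hεδ.trans hδ1) hN hFc fun η hη => by
      rw [norm_smul, norm_exp_I_mul_mul, one_mul]
      exact hb η ⟨hη.1, hη.2.trans_lt hεδ⟩
  obtain ⟨hi', hfar⟩ := integral_Ioi_norm_le_of_log_singularity hα0 hε hεδ hδ1 hN hF' hi hb'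
  obtain ⟨L, hL, hLn⟩ := exists_tendsto_oscillatory_integral hl hε hF hF' hlim hi'
  refine ⟨_, Tendsto.congr' ?_ (hL.const_add
    (∫ η in (0 : ℝ)..ε, Complex.exp (Complex.I * l * η) • F η)), ?_⟩
  · filter_upwards [eventually_ge_atTop ε] with b hεb
    refine intervalIntegral.integral_add_adjacent_intervals hint ?_
    refine (hFc.mono ?_).intervalIntegrable
    rw [uIcc_of_le hεb]
    exact fun x hx => hε.trans_le hx.1
  · refine (norm_add_le _ _).trans (add_le_add hnear (hLn.trans ?_))
    have := hb ε ⟨hε, hεδ⟩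
    gcongr

end Oscillatory

/-- The cut-off `ε = 1 / (4 l)` turns the losses at `ε` into decay in `l`. -/
lemma cutoff_bounds {α l : ℝ} (hα0 : 0 < α) (hα1 : α < 1) (hl : 1 ≤ l) :
    (1 / (4 * l)) ^ (1 - α) * (1 - Real.log (1 / (4 * l))) ≤
        12 * ((1 + Real.log l) * l ^ (α - 1)) ∧
      l⁻¹ * ((1 / (4 * l)) ^ (-α) * (1 - Real.log (1 / (4 * l)))) ≤
        12 * ((1 + Real.log l) * l ^ (α - 1)) := by
  have hl0 : 0 < l := by linarith
  have hlog := Real.log_nonneg hl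
  have hlog4 : Real.log 4 ≤ 2 := by
    rw [show (4 : ℝ) = 2 ^ 2 by norm_num, Real.log_pow]
    have := Real.log_two_lt_d9
    push_cast
    linarith
  have hlp := Real.rpow_pos_of_pos hl0 (α - 1)
  have hQ : 1 - Real.log (1 / (4 * l)) ≤ 3 * (1 + Real.log l) := by
    rw [one_div, Real.log_inv, Real.log_mul (by norm_num) hl0.ne']
    linarith
  have hQ0 : 0 < 1 - Real.log (1 / (4 * l)) :=
    one_sub_log_pos (by positivity) (by rw [div_lt_one (by positivity)]; linarith)
  have h1 : (1 / (4 * l)) ^ (1 - α) ≤ 4 * l ^ (α - 1) := by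
    rw [one_div, Real.inv_rpow (by positivity), ← Real.rpow_neg (by positivity), neg_sub,
      Real.mul_rpow (by norm_num) hl0.le]
    gcongr
    exact (Real.rpow_le_one_of_one_le_of_nonpos (by norm_num) (by linarith)).trans (by norm_num)
  have h2 : l⁻¹ * (1 / (4 * l)) ^ (-α) ≤ 4 * l ^ (α - 1) := by
    rw [one_div, Real.inv_rpow (by positivity), ← Real.rpow_neg (by positivity), neg_neg,
      Real.mul_rpow (by norm_num) hl0.le, Real.rpow_sub_one hl0.ne']
    have h4 : (4 : ℝ) ^ α ≤ 4 := by
      simpa using Real.rpow_le_rpow_of_exponent_le (by norm_num : (1 : ℝ) ≤ 4) hα1.le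
    calc l⁻¹ * (4 ^ α * l ^ α) = 4 ^ α * (l ^ α / l) := by ring
      _ ≤ 4 * (l ^ α / l) := by gcongr
  constructor
  · calc _ ≤ (4 * l ^ (α - 1)) * (3 * (1 + Real.log l)) := by gcongr
      _ = _ := by ring
  · rw [← mul_assoc]
    calc _ ≤ (4 * l ^ (α - 1)) * (3 * (1 + Real.log l)) := by gcongr
      _ = _ := by ring

/-- Lemma 4.2(ii): stationary-phase decay with a logarithmic correction
for amplitudes with a power-times-logarithm singularity at `η = 0`:
`F(η) = η^{−α}(E_{1,1}(η) + log η · E_{1,2}(η))`,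
`∂_ηF(η) = η^{−α−1}(E_{2,1}(η) + log η · E_{2,2}(η))` on `(0, δ₀)`, `δ₀ = 1/(2m)`.
Then `‖∫₀^∞ e^{imηt} F(η) dη‖_{L²} ≤ C[(1 + log(mt))(mt)^{α−1}(∑‖E_{i,j}‖_X)
+ (mt)^{−1}‖∂_ηF‖_Y]` with `C` depending only on `α`. -/
theorem stationary_phase_log_singularity (α : ℝ) (hα : α ∈ Set.Ioo (0 : ℝ) 1) :
    ∃ C : ℝ, 0 < C ∧
      ∀ (m : ℕ), 1 ≤ m → ∀ δ₀ : ℝ, δ₀ = 1 / (2 * (m : ℝ)) → ∀ t : ℝ, 1 ≤ t →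
      ∀ (F F' : ℝ → Lp ℂ 2 (volume : Measure ℝ)),
        (∀ η ∈ Set.Ioi (0 : ℝ), HasDerivAt F (F' η) η) →
        ContinuousOn F' (Set.Ioi (0 : ℝ)) →
        Filter.Tendsto (fun η => ‖F η‖) Filter.atTop (nhds 0) →
        IntegrableOn F' (Set.Ioi δ₀) →
      ∀ (E₁₁ E₁₂ E₂₁ E₂₂ : ℝ → Lp ℂ 2 (volume : Measure ℝ)) (N₁₁ N₁₂ N₂₁ N₂₂ : ℝ),
        (∀ η ∈ Set.Ioo (0 : ℝ) δ₀,
          F η = (η ^ (-α) : ℝ) • (E₁₁ η + (Real.log η) • E₁₂ η)) →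
        (∀ η ∈ Set.Ioo (0 : ℝ) δ₀,
          F' η = (η ^ (-α - 1) : ℝ) • (E₂₁ η + (Real.log η) • E₂₂ η)) →
        (∀ η ∈ Set.Ioo (0 : ℝ) δ₀, ‖E₁₁ η‖ ≤ N₁₁) →
        (∀ η ∈ Set.Ioo (0 : ℝ) δ₀, ‖E₁₂ η‖ ≤ N₁₂) →
        (∀ η ∈ Set.Ioo (0 : ℝ) δ₀, ‖E₂₁ η‖ ≤ N₂₁) →
        (∀ η ∈ Set.Ioo (0 : ℝ) δ₀, ‖E₂₂ η‖ ≤ N₂₂) →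
      ∃ L : Lp ℂ 2 (volume : Measure ℝ),
        Filter.Tendsto
          (fun b => ∫ η in (0 : ℝ)..b, Complex.exp (Complex.I * m * η * t) • F η)
          Filter.atTop (nhds L) ∧
        ‖L‖ ≤ C * ((1 + Real.log ((m : ℝ) * t)) * ((m : ℝ) * t) ^ (α - 1)
            * (N₁₁ + N₁₂ + N₂₁ + N₂₂)
          + ((m : ℝ) * t)⁻¹ * ∫ η in Set.Ioi δ₀, ‖F' η‖) := by
  obtain ⟨hα0, hα1⟩ := hα
  have hα' : 0 < 1 - α := by linarith
  set c := 1 / (1 - α) + 1 / ((1 - α) / 2) ^ 2 with hc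
  have hc0 : 0 < c := by positivity
  refine ⟨12 * (c + 1 + 1 / α) + 1, by positivity, ?_⟩
  intro m hm δ₀ hδ t ht F F' hF hF' hlim hi E₁₁ E₁₂ E₂₁ E₂₂ N₁₁ N₁₂ N₂₁ N₂₂ hE hE' h₁₁ h₁₂ h₂₁ h₂₂
  have hm1 : (1 : ℝ) ≤ m := by exact_mod_cast hm
  have hm0 : (0 : ℝ) < m := by linarith
  have hl1 : 1 ≤ (m : ℝ) * t := one_le_mul_of_one_le_of_one_le hm1 ht
  have hexp : ∀ η : ℝ, Complex.exp (Complex.I * m * η * t)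
      = Complex.exp (Complex.I * ((m : ℝ) * t : ℝ) * η) := by
    intro η
    congr 1
    push_cast
    ring
  simp_rw [hexp]
  have hml : (m : ℝ) ≤ m * t := le_mul_of_one_le_right hm0.le ht
  set l := (m : ℝ) * t
  have hl0 : 0 < l := by linarith
  have hδ0 : 0 < δ₀ := by rw [hδ]; positivity
  have hδ1 : δ₀ < 1 := by
    rw [hδ, div_lt_one (by positivity)]
    linarith
  have hε : 0 < 1 / (4 * l) := by positivity
  have hεδ : 1 / (4 * l) < δ₀ := by
    rw [hδ]
    exact one_div_lt_one_div_of_lt (by positivity) (by linarith)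
  have hmem : δ₀ / 2 ∈ Ioo 0 δ₀ := ⟨by linarith, by linarith⟩
  have n₁₁ := (norm_nonneg _).trans (h₁₁ _ hmem)
  have n₁₂ := (norm_nonneg _).trans (h₁₂ _ hmem)
  have n₂₁ := (norm_nonneg _).trans (h₂₁ _ hmem)
  have n₂₂ := (norm_nonneg _).trans (h₂₂ _ hmem)
  set N := N₁₁ + N₁₂ + N₂₁ + N₂₂ with hN
  have hN0 : 0 ≤ N := by positivity
  obtain ⟨L, hL, hLn⟩ := exists_tendsto_oscillatory_integral_of_log_singularity hα0 hα1 hl0 hε hεδ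
    hδ1 hN0 hF hF' hlim hi
    (fun η hη => by
      rw [hE η hη]
      exact norm_rpow_smul_add_log_smul_le hη.1 (hη.2.trans hδ1) (h₁₁ η hη) (h₁₂ η hη)
        (by linarith))
    (fun η hη => by
      rw [hE' η hη]
      exact norm_rpow_smul_add_log_smul_le hη.1 (hη.2.trans hδ1) (h₂₁ η hη) (h₂₂ η hη)
        (by linarith))
  refine ⟨L, hL, hLn.trans ?_⟩
  obtain ⟨hA, hB⟩ := cutoff_bounds hα0 hα1 hl1
  rw [← hc]
  set P := (1 / (4 * l)) ^ (1 - α) * (1 - Real.log (1 / (4 * l)))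
  set R := (1 / (4 * l)) ^ (-α) * (1 - Real.log (1 / (4 * l)))
  set D := (1 + Real.log l) * l ^ (α - 1)
  have hD : 0 ≤ D := mul_nonneg (by linarith [Real.log_nonneg hl1]) (Real.rpow_nonneg hl0.le _)
  have hY : 0 ≤ ∫ η in Ioi δ₀, ‖F' η‖ := integral_nonneg fun _ => norm_nonneg _
  set Y := ∫ η in Ioi δ₀, ‖F' η‖
  calc c * P * N + l⁻¹ * (R * N + (1 / α * R * N + Y))
      = c * P * N + (1 + 1 / α) * (l⁻¹ * R) * N + l⁻¹ * Y := by ring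
    _ ≤ c * (12 * D) * N + (1 + 1 / α) * (12 * D) * N + l⁻¹ * Y := by gcongr
    _ = 12 * (c + 1 + 1 / α) * (D * N) + 1 * (l⁻¹ * Y) := by ring
    _ ≤ (12 * (c + 1 + 1 / α) + 1) * (D * N) + (12 * (c + 1 + 1 / α) + 1) * (l⁻¹ * Y) := by
        gcongr
        · linarith
        · have : 0 ≤ 12 * (c + 1 + 1 / α) := by positivity
          linarith
    _ = (12 * (c + 1 + 1 / α) + 1) * (D * N + l⁻¹ * Y) := by ring
end
end
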